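/- Let F be a positive DNF formula over n variables, and consider GameSAT on F in which each player on their turn must assign a truth value to a currently-unset variable (no skipping), with a fixed choice of which player moves first. If Fallon has a winning strategy, then Fallon has a winning strategy in which every move he makes assigns the value false. -/

import Mathlib

/-- A positive DNF formula over variables `Fin n` is an OR of clauses, each an
AND of (unnegated) variables, represented as a list of finite sets of variables.
`evalDNF F s` evaluates `F` under the (partial) assignment `s`: some clause has
all its variables assigned `true`. -/
def evalDNF {n : ℕ} (F : List (Finset (Fin n))) (s : Fin n → Option Bool) : Bool :=
  F.any fun C => decide (∀ v ∈ C, s v = some true)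

/-- Playing out GameSAT on the positive DNF formula `F` for `fuel` further moves
from partial assignment `s`, with `t = true` iff it is Trudy's turn.  Trudy
follows strategy `σ`, Fallon follows strategy `τ`; a strategy names, for the
current partial assignment, a variable together with the truth value to assign
to it.  Each player must assign a value to a currently-unset variable (a player
naming an already-set variable cannot legally move and loses).  When the fuel is
exhausted (after `n` moves from the empty assignment all variables are set), the
result is whether Trudy wins: `true` iff `F` evaluates to true. -/
def playGameSAT {n : ℕ} (F : List (Finset (Fin n)))
    (σ τ : (Fin n → Option Bool) → Fin n × Bool) :
    ℕ → (Fin n → Option Bool) → Bool → Bool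
  | 0, s, _ => evalDNF F s
  | fuel + 1, s, t =>
    let m := if t then σ s else τ s
    if s m.1 = none then
      playGameSAT F σ τ fuel (Function.update s m.1 (some m.2)) (!t)
    else !t

/-- Fallon can force a win in GameSAT on `F` with `k` moves left from the partial assignment `s`,
where `t = true` iff it is Trudy's turn. -/
def FallonWins {n : ℕ} (F : List (Finset (Fin n))) : ℕ → (Fin n → Option Bool) → Bool → Prop
  | 0, s, _ => evalDNF F s = false
  | k + 1, s, true => ∀ v b, s v = none → FallonWins F k (Function.update s v (some b)) false
  | k + 1, s, false => ∃ v b, s v = none ∧ FallonWins F k (Function.update s v (some b)) true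

/-- The number of variables left unset by `s`. -/
def unsetCount {n : ℕ} (s : Fin n → Option Bool) : ℕ :=
  (Finset.univ.filter fun v => s v = none).card

lemma unsetCount_update {n : ℕ} {s : Fin n → Option Bool} {v : Fin n} (hv : s v = none)
    (b : Bool) : unsetCount (Function.update s v (some b)) = unsetCount s - 1 := by
  have h : (Finset.univ.filter fun w => Function.update s v (some b) w = none) =
      (Finset.univ.filter fun w => s w = none).erase v := by
    ext w
    by_cases hw : w = v
    · subst hw; simp
    · simp [hw]
  rw [unsetCount, h, Finset.card_erase_of_mem (by simpa using hv), unsetCount]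

/-- Fallon's winning positions are closed under turning assigned values from true to false. -/
lemma FallonWins.mono {n : ℕ} {F : List (Finset (Fin n))} {k : ℕ} {s s' : Fin n → Option Bool}
    {t : Bool} (h : FallonWins F k s t) (hnone : ∀ v, s v = none ↔ s' v = none)
    (htrue : ∀ v, s' v = some true → s v = some true) : FallonWins F k s' t := by
  induction k generalizing s s' t with
  | zero =>
    simp only [FallonWins, evalDNF, List.any_eq_false, decide_eq_true_eq] at h ⊢
    exact fun C hC hs' => h C hC fun v hv => htrue v (hs' v hv)
  | succ k ih =>
    have step (v : Fin n) (b t : Bool) (hk : FallonWins F k (Function.update s v (some b)) t) :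
        FallonWins F k (Function.update s' v (some b)) t := by
      refine ih hk (fun w => ?_) fun w => ?_ <;> by_cases hw : w = v
      · simp [hw]
      · simpa [hw] using hnone w
      · simp [hw]
      · simpa [hw] using htrue w
    cases t with
    | true => exact fun v b hv => step v b _ (h v b ((hnone v).2 hv))
    | false =>
      obtain ⟨v, b, hv, hk⟩ := h
      exact ⟨v, b, (hnone v).1 hv, step v b _ hk⟩

/-- From a winning position Fallon has a winning move that assigns `false`. -/
lemma FallonWins.exists_false_move {n : ℕ} {F : List (Finset (Fin n))} {k : ℕ}
    {s : Fin n → Option Bool} (h : FallonWins F (k + 1) s false) :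
    ∃ v, s v = none ∧ FallonWins F k (Function.update s v (some false)) true := by
  obtain ⟨v, b, hv, hk⟩ := h
  refine ⟨v, hv, hk.mono (fun w => ?_) fun w => ?_⟩ <;> by_cases hw : w = v <;> simp [hw]

/-- Trudy has a strategy that wins from every position that is not winning for Fallon. -/
lemma exists_trudy_strategy {n : ℕ} [Nonempty (Fin n)] (F : List (Finset (Fin n))) :
    ∃ σ, ∀ τ k s t, unsetCount s = k → ¬ FallonWins F k s t →
      playGameSAT F σ τ k s t = true := by
  have hmove (s : Fin n → Option Bool) : ∃ m : Fin n × Bool,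
      ∀ k, unsetCount s = k + 1 → ¬ FallonWins F (k + 1) s true →
        s m.1 = none ∧ ¬ FallonWins F k (Function.update s m.1 (some m.2)) false := by
    by_cases h : ∃ k, unsetCount s = k + 1 ∧ ¬ FallonWins F (k + 1) s true
    · obtain ⟨k, hk, hw⟩ := h
      simp only [FallonWins, not_forall] at hw
      obtain ⟨v, b, hv, hw⟩ := hw
      refine ⟨(v, b), fun j hj _ => ?_⟩
      obtain rfl : j = k := by omega
      exact ⟨hv, hw⟩
    · exact ⟨(Classical.arbitrary _, true), fun k hk hw => absurd ⟨k, hk, hw⟩ h⟩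
  choose σ hσ using hmove
  refine ⟨σ, fun τ k => ?_⟩
  induction k with
  | zero => exact fun s t _ hw => by simpa [FallonWins, playGameSAT] using hw
  | succ k ih =>
    intro s t hk hw
    cases t with
    | true =>
      obtain ⟨hv, hw'⟩ := hσ s k hk hw
      simpa [playGameSAT, hv] using ih _ _ (by rw [unsetCount_update hv, hk]; rfl) hw'
    | false =>
      by_cases hv : s (τ s).1 = none
      · simpa [playGameSAT, hv] using ih _ _ (by rw [unsetCount_update hv, hk]; rfl)
          fun hk' => hw ⟨_, _, hv, hk'⟩
      · simp [playGameSAT, hv]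

/-- Fallon has a strategy that always assigns `false` and wins from each of his winning
positions. -/
lemma exists_fallon_false_strategy {n : ℕ} [Nonempty (Fin n)] (F : List (Finset (Fin n))) :
    ∃ τ : (Fin n → Option Bool) → Fin n × Bool, (∀ s, (τ s).2 = false) ∧
      ∀ σ k s t, unsetCount s = k → FallonWins F k s t →
        playGameSAT F σ τ k s t = false := by
  have hmove (s : Fin n → Option Bool) : ∃ v : Fin n,
      ∀ k, unsetCount s = k + 1 → FallonWins F (k + 1) s false →
        s v = none ∧ FallonWins F k (Function.update s v (some false)) true := by
    by_cases h : ∃ k, unsetCount s = k + 1 ∧ FallonWins F (k + 1) s false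
    · obtain ⟨k, hk, hw⟩ := h
      obtain ⟨v, hv, hw⟩ := hw.exists_false_move
      refine ⟨v, fun j hj _ => ?_⟩
      obtain rfl : j = k := by omega
      exact ⟨hv, hw⟩
    · exact ⟨Classical.arbitrary _, fun k hk hw => absurd ⟨k, hk, hw⟩ h⟩
  choose f hf using hmove
  refine ⟨fun s => (f s, false), fun _ => rfl, fun σ k => ?_⟩
  induction k with
  | zero => exact fun s t _ hw => by simpa [FallonWins, playGameSAT] using hw
  | succ k ih =>
    intro s t hk hw
    cases t with
    | false =>
      obtain ⟨hv, hw'⟩ := hf s k hk hw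
      simpa [playGameSAT, hv] using ih _ _ (by rw [unsetCount_update hv, hk]; rfl) hw'
    | true =>
      by_cases hv : s (σ s).1 = none
      · simpa [playGameSAT, hv] using ih _ _ (by rw [unsetCount_update hv, hk]; rfl)
          (hw _ _ hv)
      · simp [playGameSAT, hv]

/-- GameSAT on a positive DNF formula `F` over `n` variables, with a fixed choice
`trudyFirst` of who moves first; players alternate, each assigning a truth value
to a currently-unset variable (no skipping); Trudy wins iff `F` is true at the
end, and Fallon wins otherwise.  If Fallon has a winning strategy, then he has a
winning strategy in which every move he makes assigns the value `false`. -/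
theorem fallon_can_always_play_false {n : ℕ} (F : List (Finset (Fin n)))
    (trudyFirst : Bool)
    (h : ∃ τ, ∀ σ, playGameSAT F σ τ n (fun _ => none) trudyFirst = false) :
    ∃ τ, (∀ s, (τ s).2 = false) ∧
      ∀ σ, playGameSAT F σ τ n (fun _ => none) trudyFirst = false := by
  obtain ⟨τ, hτ⟩ := h
  have : Nonempty (Fin n) := ⟨(τ fun _ => none).1⟩
  have hn : unsetCount (fun _ : Fin n => none) = n := by simp [unsetCount]
  obtain ⟨σ, hσ⟩ := exists_trudy_strategy F
  obtain ⟨τ', hfalse, hwin⟩ := exists_fallon_false_strategy F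
  refine ⟨τ', hfalse, fun σ' => hwin σ' n _ _ hn ?_⟩
  by_contra hw
  simpa [hτ σ] using hσ τ n _ _ hn hw
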